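/- arXiv:1707.08270 — 2 statements merged into one kernel-verified Lean document; each statement's English description precedes it below -/
import Mathlib

section
/- (Lower bound with penalties.) Consider an instance of Capacitated Vehicle Routing with Penalties: a metric space (X, d), depot s ∈ X, integer capacity Q ≥ 1, finite client set Z ⊆ X with s ∉ Z, demands ρ : Z → ℕ with 1 ≤ ρ(c) ≤ Q, and penalties p : Z → ℝ≥0. Suppose a solution visits exactly the clients of a subset U ⊆ Z, via a feasible collection of tours for client set U (each client of U in exactly one tour exactly once, total demand per tour at most Q), and pays the penalty p(c) for each c ∈ W = Z \ U. Then its objective value (sum of tour lengths plus sum of penalties of unvisited clients) is at least (2/Q) · Σ_{c ∈ U} d(s, c) + Σ_{c ∈ W} p(c). -/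
/-- The length of a path visiting the given list of points, under metric `d`:
the sum of distances between consecutive points. -/
def pathLength {X : Type*} (d : X → X → ℝ) : List X → ℝ
  | [] => 0
  | [_] => 0
  | x :: y :: rest => d x y + pathLength d (y :: rest)

/-- The length of a depot-to-depot tour visiting the clients `t` in order. -/
def tourLength {X : Type*} [MetricSpace X] (s : X) (t : List X) : ℝ :=
  pathLength dist (s :: (t ++ [s]))

/-- Feasibility of a collection of tours for client set `U`:
every point on a tour is a client of `U`, every client of `U` appears exactly
once over all tours, and each tour covers at most `Q` units of demand. -/
def FeasibleCVR {X : Type*} [DecidableEq X]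
    (U : Finset X) (ρ : X → ℕ) (Q : ℕ) (tours : List (List X)) : Prop :=
  (∀ t ∈ tours, ∀ c ∈ t, c ∈ U) ∧
  (∀ c ∈ U, (tours.flatMap id).count c = 1) ∧
  (∀ t ∈ tours, (t.map ρ).sum ≤ Q)

theorem dist_le_pathLength {X : Type*} [MetricSpace X] (x y : X) (t : List X) :
    dist x y ≤ pathLength dist (x :: (t ++ [y])) := by
  induction t generalizing x with
  | nil => simp [pathLength]
  | cons a t ih =>
    have h := ih a
    have := dist_triangle x a y
    simp only [List.cons_append, pathLength] at h ⊢
    linarith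

theorem dist_add_dist_le_pathLength {X : Type*} [MetricSpace X] (x y c : X) (t : List X)
    (hc : c ∈ t) : dist x c + dist c y ≤ pathLength dist (x :: (t ++ [y])) := by
  induction t generalizing x with
  | nil => simp at hc
  | cons a t ih =>
    simp only [List.cons_append, pathLength]
    rcases List.mem_cons.mp hc with rfl | h
    · linarith [dist_le_pathLength c y t]
    · linarith [ih a h, dist_triangle x a c]

theorem two_mul_dist_le_tourLength {X : Type*} [MetricSpace X] (s c : X) (t : List X)
    (hc : c ∈ t) : 2 * dist s c ≤ tourLength s t := by
  have h := dist_add_dist_le_pathLength s s c t hc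
  rw [dist_comm c s] at h
  unfold tourLength
  linarith

theorem tourLength_nonneg {X : Type*} [MetricSpace X] (s : X) (t : List X) :
    0 ≤ tourLength s t :=
  dist_nonneg.trans (dist_le_pathLength s s t)

/-- A tour of demand at most `Q` is at least `2 / Q` times the radial distances it covers. -/
theorem two_div_mul_sum_dist_le_tourLength {X : Type*} [MetricSpace X] (s : X) {Q : ℕ}
    (hQ : 1 ≤ Q) (ρ : X → ℕ) (t : List X) (hρ : ∀ c ∈ t, 1 ≤ ρ c) (ht : (t.map ρ).sum ≤ Q) :
    2 / (Q : ℝ) * (t.map (dist s)).sum ≤ tourLength s t := by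
  have hsum : (t.map (dist s)).sum ≤ t.length * (tourLength s t / 2) := by
    have h := List.sum_le_card_nsmul (t.map (dist s)) (tourLength s t / 2) (by
      intro x hx
      obtain ⟨c, hc, rfl⟩ := List.mem_map.mp hx
      linarith [two_mul_dist_le_tourLength s c t hc])
    simpa using h
  have hlen : t.length ≤ Q := by
    have h := List.card_nsmul_le_sum (t.map ρ) 1 (by simpa using hρ)
    simp only [List.length_map, smul_eq_mul, mul_one] at h
    exact h.trans ht
  have hlen' : (t.length : ℝ) ≤ Q := by exact_mod_cast hlen
  have hQ' : (0 : ℝ) < Q := by exact_mod_cast hQ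
  rw [div_mul_eq_mul_div, div_le_iff₀ hQ']
  nlinarith [mul_le_mul_of_nonneg_right hlen' (tourLength_nonneg s t)]

theorem FeasibleCVR.sum_eq {X : Type*} [DecidableEq X] {U : Finset X} {ρ : X → ℕ} {Q : ℕ}
    {tours : List (List X)} (h : FeasibleCVR U ρ Q tours) (f : X → ℝ) :
    ∑ c ∈ U, f c = (tours.map fun t => (t.map f).sum).sum := by
  obtain ⟨hmem, hcount, -⟩ := h
  have hU : ∀ c ∈ tours.flatMap id, c ∈ U := by
    intro c hc
    obtain ⟨t, ht, hct⟩ := List.mem_flatMap.mp hc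
    exact hmem t ht c hct
  have hnodup : (tours.flatMap id).Nodup := by
    rw [List.nodup_iff_count_le_one]
    intro c
    by_cases hc : c ∈ tours.flatMap id
    · exact (hcount c (hU c hc)).le
    · exact (List.count_eq_zero_of_not_mem hc).le.trans zero_le_one
  have hfin : (tours.flatMap id).toFinset = U := by
    ext c
    rw [List.mem_toFinset]
    refine ⟨hU c, fun hc => List.count_pos_iff.mp ?_⟩
    rw [hcount c hc]
    exact one_pos
  rw [← hfin, List.sum_toFinset f hnodup]
  simp [Function.comp_def]

theorem penalties_lower_bound {X : Type*} [MetricSpace X] [DecidableEq X]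
    (s : X) (Q : ℕ) (hQ : 1 ≤ Q)
    (Z : Finset X) (hsZ : s ∉ Z)
    (ρ : X → ℕ) (hρ : ∀ c ∈ Z, 1 ≤ ρ c ∧ ρ c ≤ Q)
    (p : X → ℝ) (hp : ∀ c ∈ Z, 0 ≤ p c)
    (U : Finset X) (hUZ : U ⊆ Z)
    (tours : List (List X)) (hfeas : FeasibleCVR U ρ Q tours) :
    (2 / (Q : ℝ)) * ∑ c ∈ U, dist s c + ∑ c ∈ Z \ U, p c ≤
      (tours.map (tourLength s)).sum + ∑ c ∈ Z \ U, p c := by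
  rw [hfeas.sum_eq (dist s), ← List.sum_map_mul_left]
  gcongr
  refine List.sum_le_sum fun t ht => ?_
  exact two_div_mul_sum_dist_le_tourLength s hQ ρ t
    (fun c hc => (hρ c (hUZ (hfeas.1 t ht c hc))).1) (hfeas.2.2 t ht)
end

section
/- (Vehicle-routing transfer with penalties.) Let X be a set equipped with two metrics d_G and d_H, let s ∈ X, Q an integer ≥ 1, and ε ≥ 0, and suppose that for all u, v ∈ X: d_G(u, v) ≤ d_H(u, v) ≤ d_G(u, v) + ε·(d_G(s, u) + d_G(s, v)). Fix an instance of Capacitated Vehicle Routing with Penalties with depot s, capacity Q, finite client set Z ⊆ X with s ∉ Z, demands ρ : Z → ℕ with 1 ≤ ρ(c) ≤ Q, and penalties p : Z → ℝ≥0. For a solution (U, P) visiting the clients of U ⊆ Z via the feasible tour collection P, let obj_d(U, P) = cost_d(P) + Σ_{c ∈ Z∖U} p(c). Then for every feasible solution (U, P), obj_H(U, P) ≤ (1 + εQ)·obj_G(U, P); consequently, if (U*, P*) minimizes obj_H among all feasible solutions, then obj_G(U*, P*) ≤ (1 + εQ)·obj_G(U, P) for every feasible solution (U, P). -/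
/-- The cost, under metric `d`, of a collection of depot-to-depot tours. -/
def solCost {X : Type*} (d : X → X → ℝ) (s : X) (tours : List (List X)) : ℝ :=
  (tours.map (fun t => pathLength d (s :: (t ++ [s])))).sum

/-- The objective of a solution to Capacitated Vehicle Routing with Penalties:
the total tour length under `d` plus the penalties of unvisited clients. -/
def objPen {X : Type*} [DecidableEq X] (d : X → X → ℝ) (s : X) (Z : Finset X)
    (p : X → ℝ) (U : Finset X) (tours : List (List X)) : ℝ :=
  solCost d s tours + ∑ c ∈ Z \ U, p c

/-- A path from `a` to `b` is at least as long as the detour from `a` to `b` via any of its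
vertices. -/
lemma add_le_pathLength_of_mem {X : Type*} {d : X → X → ℝ} (hself : ∀ x, d x x = 0)
    (htri : ∀ x y z, d x z ≤ d x y + d y z) (b : X) {c : X} (t : List X) (a : X)
    (hc : c ∈ a :: t) : d a c + d c b ≤ pathLength d (a :: (t ++ [b])) := by
  induction t generalizing a c with
  | nil =>
    obtain rfl : c = a := by simpa using hc
    simp [pathLength, hself]
  | cons x t ih =>
    change _ ≤ d a x + pathLength d (x :: (t ++ [b]))
    rcases List.mem_cons.1 hc with rfl | hc
    · have h := ih x List.mem_cons_self
      linarith [htri c x b, hself c, hself x]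
    · linarith [ih x hc, htri a x c]

/-- The additive error of a path ending at `s` when each edge `u v` has error at most
`ε * (d s u + d s v)`. -/
lemma pathLength_le_add_sum {X : Type*} {d d' : X → X → ℝ} {s : X} {ε : ℝ}
    (hself : d s s = 0) (hub : ∀ u v, d' u v ≤ d u v + ε * (d s u + d s v))
    (t : List X) (a : X) :
    pathLength d' (a :: (t ++ [s])) ≤
      pathLength d (a :: (t ++ [s])) + ε * (d s a + 2 * (t.map (d s)).sum) := by
  induction t generalizing a with
  | nil => simpa [pathLength, hself] using hub a s
  | cons x t ih =>
    change d' a x + pathLength d' (x :: (t ++ [s])) ≤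
      d a x + pathLength d (x :: (t ++ [s])) + _
    rw [List.map_cons, List.sum_cons]
    linarith [ih x, hub a x]

/-- A depot tour with at most `Q` stops is stretched by a factor of at most `1 + ε * Q`. -/
lemma pathLength_tour_le {X : Type*} {d d' : X → X → ℝ} {s : X} {ε : ℝ} {Q : ℕ}
    (hself : ∀ x, d x x = 0) (hsymm : ∀ x y, d x y = d y x)
    (htri : ∀ x y z, d x z ≤ d x y + d y z) (hε : 0 ≤ ε)
    (hub : ∀ u v, d' u v ≤ d u v + ε * (d s u + d s v))
    (t : List X) (ht : t.length ≤ Q) :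
    pathLength d' (s :: (t ++ [s])) ≤ (1 + ε * Q) * pathLength d (s :: (t ++ [s])) := by
  have hvia : ∀ c ∈ s :: t, d s c + d c s ≤ pathLength d (s :: (t ++ [s])) := fun c hc ↦
    add_le_pathLength_of_mem hself htri s t s hc
  have hsum : (t.map (d s)).sum ≤ t.length * (pathLength d (s :: (t ++ [s])) / 2) := by
    have h := List.sum_le_card_nsmul (t.map (d s)) (pathLength d (s :: (t ++ [s])) / 2) (by
      intro x hx
      obtain ⟨c, hc, rfl⟩ := List.mem_map.1 hx
      linarith [hvia c (List.mem_cons_of_mem _ hc), hsymm s c])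
    simpa using h
  have hnonneg : 0 ≤ pathLength d (s :: (t ++ [s])) := by
    linarith [hvia s List.mem_cons_self, hself s]
  have hcard : (t.length : ℝ) * pathLength d (s :: (t ++ [s])) ≤
      Q * pathLength d (s :: (t ++ [s])) := by gcongr
  have herr : ε * (d s s + 2 * (t.map (d s)).sum) ≤
      ε * (Q * pathLength d (s :: (t ++ [s]))) :=
    mul_le_mul_of_nonneg_left (by linarith [hself s]) hε
  linarith [pathLength_le_add_sum (hself s) hub t s]

lemma solCost_le_mul {X : Type*} {d d' : X → X → ℝ} {s : X} {K : ℝ} (P : List (List X))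
    (h : ∀ t ∈ P, pathLength d' (s :: (t ++ [s])) ≤ K * pathLength d (s :: (t ++ [s]))) :
    solCost d' s P ≤ K * solCost d s P := by
  rw [solCost, solCost, ← List.sum_map_mul_left]
  exact List.sum_le_sum h

lemma pathLength_mono {X : Type*} {d d' : X → X → ℝ} (h : ∀ u v, d u v ≤ d' u v) :
    ∀ l : List X, pathLength d l ≤ pathLength d' l
  | [] => le_rfl
  | [_] => le_rfl
  | x :: y :: l => add_le_add (h x y) (pathLength_mono h (y :: l))

lemma objPen_mono {X : Type*} [DecidableEq X] {d d' : X → X → ℝ}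
    (h : ∀ u v, d u v ≤ d' u v) (s : X) (Z : Finset X) (p : X → ℝ) (U : Finset X)
    (P : List (List X)) : objPen d s Z p U P ≤ objPen d' s Z p U P :=
  add_le_add_left (List.sum_le_sum fun _ _ ↦ pathLength_mono h _) _

theorem vehicle_routing_penalties_transfer {X : Type*} [DecidableEq X]
    (dG dH : X → X → ℝ)
    (hGself : ∀ x, dG x x = 0) (hGeq : ∀ x y, dG x y = 0 → x = y)
    (hGsymm : ∀ x y, dG x y = dG y x)
    (hGtri : ∀ x y z, dG x z ≤ dG x y + dG y z)
    (hHself : ∀ x, dH x x = 0) (hHeq : ∀ x y, dH x y = 0 → x = y)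
    (hHsymm : ∀ x y, dH x y = dH y x)
    (hHtri : ∀ x y z, dH x z ≤ dH x y + dH y z)
    (s : X) (Q : ℕ) (hQ : 1 ≤ Q) (ε : ℝ) (hε : 0 ≤ ε)
    (hle : ∀ u v, dG u v ≤ dH u v)
    (hub : ∀ u v, dH u v ≤ dG u v + ε * (dG s u + dG s v))
    (Z : Finset X) (hsZ : s ∉ Z)
    (ρ : X → ℕ) (hρ : ∀ c ∈ Z, 1 ≤ ρ c ∧ ρ c ≤ Q)
    (p : X → ℝ) (hp : ∀ c ∈ Z, 0 ≤ p c) :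
    (∀ (U : Finset X) (P : List (List X)), U ⊆ Z → FeasibleCVR U ρ Q P →
      objPen dH s Z p U P ≤ (1 + ε * Q) * objPen dG s Z p U P) ∧
    (∀ (Ustar : Finset X) (Pstar : List (List X)),
      Ustar ⊆ Z → FeasibleCVR Ustar ρ Q Pstar →
      (∀ (U : Finset X) (P : List (List X)), U ⊆ Z → FeasibleCVR U ρ Q P →
        objPen dH s Z p Ustar Pstar ≤ objPen dH s Z p U P) →
      ∀ (U : Finset X) (P : List (List X)), U ⊆ Z → FeasibleCVR U ρ Q P →
        objPen dG s Z p Ustar Pstar ≤ (1 + ε * Q) * objPen dG s Z p U P) := by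
  have htransfer : ∀ (U : Finset X) (P : List (List X)), U ⊆ Z → FeasibleCVR U ρ Q P →
      objPen dH s Z p U P ≤ (1 + ε * Q) * objPen dG s Z p U P := by
    rintro U P hUZ ⟨hmem, -, hcap⟩
    have hcost : solCost dH s P ≤ (1 + ε * Q) * solCost dG s P := by
      refine solCost_le_mul P fun t ht ↦
        pathLength_tour_le hGself hGsymm hGtri hε hub t (le_trans ?_ (hcap t ht))
      have h := List.card_nsmul_le_sum (t.map ρ) 1 (by
        intro n hn
        obtain ⟨c, hc, rfl⟩ := List.mem_map.1 hn
        exact (hρ c (hUZ (hmem t ht c hc))).1)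
      simpa using h
    have hpen : 0 ≤ ∑ c ∈ Z \ U, p c :=
      Finset.sum_nonneg fun c hc ↦ hp c (Finset.mem_sdiff.1 hc).1
    have hextra : 0 ≤ ε * Q * ∑ c ∈ Z \ U, p c := by positivity
    simp only [objPen]
    linarith
  exact ⟨htransfer, fun Ustar Pstar _ _ hmin U P hUZ hP ↦
    (objPen_mono hle s Z p Ustar Pstar).trans ((hmin U P hUZ hP).trans (htransfer U P hUZ hP))⟩
end
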